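/- Fix n ≥ 1, a real number h, real numbers θ_1,…,θ_n with sin((θ_j−θ_k)/2) ≠ 0 for all j ≠ k, and real numbers U_1,…,U_n satisfying, for every j = 1,…,n, the null vector equation (1/2)U_j^2 + Σ_{k≠j} cot((θ_k−θ_j)/2)·U_k − Σ_{k≠j} 3/(2 sin^2((θ_j−θ_k)/2)) = h. Set p_j = U_j + Σ_{k≠j} cot((θ_j−θ_k)/2). Then the Calogero–Sutherland energy satisfies Σ_{j=1}^n p_j^2/2 − 4·Σ_{1≤j<k≤n} 1/sin^2((θ_j−θ_k)/2) = n·h − n(n^2−1)/6. -/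

import Mathlib

open Finset

/-- The momentum `p_j = U_j + Σ_{k≠j} cot((θ_j − θ_k)/2)`. -/
noncomputable def pmom (n : ℕ) (θ U : Fin n → ℝ) (j : Fin n) : ℝ :=
  U j + ∑ k ∈ univ.filter (fun k => k ≠ j),
    Real.cos ((θ j - θ k) / 2) / Real.sin ((θ j - θ k) / 2)

open Real in
theorem cot_mul_cot_cyclic {x y z : ℝ} (hxyz : x + y + z = 0)
    (hx : sin x ≠ 0) (hy : sin y ≠ 0) (hz : sin z ≠ 0) :
    cos x / sin x * (cos y / sin y) + cos y / sin y * (cos z / sin z)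
      + cos z / sin z * (cos x / sin x) = 1 := by
  obtain rfl : z = -(x + y) := by linarith
  rw [sin_neg, neg_ne_zero, sin_add] at hz
  rw [sin_neg, cos_neg, sin_add, cos_add]
  field_simp
  ring

/-- The half-angle cotangent `cot((θ_j − θ_k)/2)`; it vanishes for `j = k`. -/
noncomputable def cotHalf {ι : Type*} (θ : ι → ℝ) (j k : ι) : ℝ :=
  Real.cos ((θ j - θ k) / 2) / Real.sin ((θ j - θ k) / 2)

/-- The pair potential `1 / sin²((θ_j − θ_k)/2)`; it vanishes for `j = k`. -/
noncomputable def cscSqHalf {ι : Type*} (θ : ι → ℝ) (j k : ι) : ℝ :=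
  1 / Real.sin ((θ j - θ k) / 2) ^ 2

section

variable {ι : Type*} (θ : ι → ℝ)

@[simp] theorem cotHalf_self (j : ι) : cotHalf θ j j = 0 := by simp [cotHalf]

@[simp] theorem cscSqHalf_self (j : ι) : cscSqHalf θ j j = 0 := by simp [cscSqHalf]

theorem half_sub_comm (j k : ι) : (θ j - θ k) / 2 = -((θ k - θ j) / 2) := by ring

theorem cotHalf_swap (j k : ι) : cotHalf θ j k = -cotHalf θ k j := by
  simp only [cotHalf]
  rw [half_sub_comm, Real.sin_neg, Real.cos_neg, div_neg]

theorem cscSqHalf_comm (j k : ι) : cscSqHalf θ j k = cscSqHalf θ k j := by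
  simp only [cscSqHalf]
  rw [half_sub_comm, Real.sin_neg, neg_sq]

variable {θ}

theorem cotHalf_sq {j k : ι} (hjk : Real.sin ((θ j - θ k) / 2) ≠ 0) :
    cotHalf θ j k ^ 2 = cscSqHalf θ j k - 1 := by
  simp only [cotHalf, cscSqHalf]
  field_simp
  linarith [Real.sin_sq_add_cos_sq ((θ j - θ k) / 2)]

theorem cotHalf_cyclic [DecidableEq ι]
    (hθ : ∀ j k : ι, j ≠ k → Real.sin ((θ j - θ k) / 2) ≠ 0) (j k l : ι) :
    cotHalf θ j k * cotHalf θ j l + cotHalf θ k l * cotHalf θ k j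
        + cotHalf θ l j * cotHalf θ l k
      = -1 + (if j = k then cscSqHalf θ k l else 0) + (if k = l then cscSqHalf θ l j else 0)
        + (if l = j then cscSqHalf θ j k else 0) + (if j = k then if k = l then 1 else 0 else 0) := by
  rcases eq_or_ne j k with rfl | hjk
  · rcases eq_or_ne j l with rfl | hjl
    · simp
    · have := cotHalf_sq (hθ l j hjl.symm)
      simp [hjl, hjl.symm, cscSqHalf_comm θ j l]
      linarith
  rcases eq_or_ne k l with rfl | hkl
  · have := cotHalf_sq (hθ j k hjk)
    simp [hjk, hjk.symm, cscSqHalf_comm θ k j]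
    linarith
  rcases eq_or_ne l j with rfl | hlj
  · have := cotHalf_sq (hθ k l hkl)
    simp [hjk, hkl, cscSqHalf_comm θ l k]
    linarith
  have key : cotHalf θ j k * cotHalf θ k l + cotHalf θ k l * cotHalf θ l j
      + cotHalf θ l j * cotHalf θ j k = 1 :=
    cot_mul_cot_cyclic (by ring) (hθ j k hjk) (hθ k l hkl) (hθ l j hlj)
  simp only [hjk, hkl, hlj, if_false]
  rw [cotHalf_swap θ j l, cotHalf_swap θ k j, cotHalf_swap θ l k]
  linarith

theorem sum_sq_sum_cotHalf [Fintype ι]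
    (hθ : ∀ j k : ι, j ≠ k → Real.sin ((θ j - θ k) / 2) ≠ 0) :
    ∑ j, (∑ k, cotHalf θ j k) ^ 2
      = ∑ j, ∑ k, cscSqHalf θ j k
        - (Fintype.card ι : ℝ) * ((Fintype.card ι : ℝ) ^ 2 - 1) / 3 := by
  classical
  have hexp : ∑ j, (∑ k, cotHalf θ j k) ^ 2
      = ∑ j, ∑ k, ∑ l, cotHalf θ j k * cotHalf θ j l := by
    simp only [sq, sum_mul_sum]
  have hrot (f : ι → ι → ι → ℝ) : ∑ j, ∑ k, ∑ l, f k l j = ∑ j, ∑ k, ∑ l, f j k l := by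
    rw [sum_comm]
    exact sum_congr rfl fun _ _ => sum_comm
  have hcyc := sum_congr rfl fun j (_ : j ∈ (univ : Finset ι)) =>
    sum_congr rfl fun k (_ : k ∈ (univ : Finset ι)) =>
      sum_congr rfl fun l (_ : l ∈ (univ : Finset ι)) => cotHalf_cyclic hθ j k l
  simp only [sum_add_distrib] at hcyc
  have h₁ := hrot fun j k l => cotHalf θ j k * cotHalf θ j l
  have h₂ := hrot fun j k l => cotHalf θ k l * cotHalf θ k j
  have d₀ : ∑ j : ι, ∑ k : ι, ∑ l : ι, (if j = k then cscSqHalf θ k l else 0)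
      = ∑ j, ∑ k, cscSqHalf θ j k := by
    refine sum_congr rfl fun j _ => ?_
    rw [sum_comm]
    simp
  have d₁ := hrot fun j k l => if j = k then cscSqHalf θ k l else 0
  have d₂ := hrot fun j k l => if k = l then cscSqHalf θ l j else 0
  have hone : ∑ j : ι, ∑ k : ι, ∑ l : ι, (if j = k then if k = l then (1 : ℝ) else 0 else 0)
      = Fintype.card ι := by
    refine (sum_congr rfl fun j _ => sum_comm).trans ?_
    simp
  have hneg : ∑ _j : ι, ∑ _k : ι, ∑ _l : ι, (-1 : ℝ) = -(Fintype.card ι : ℝ) ^ 3 := by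
    simp
    ring
  linarith

theorem sum_sum_eq_two_mul_sum_lt [Fintype ι] [LinearOrder ι] {f : ι → ι → ℝ}
    (hsymm : ∀ j k, f j k = f k j) (hdiag : ∀ j, f j j = 0) :
    ∑ j, ∑ k, f j k = 2 * ∑ j, ∑ k ∈ univ.filter (fun k => j < k), f j k := by
  have hsplit (j k : ι) :
      f j k = (if j < k then f j k else 0) + (if k < j then f k j else 0) := by
    rcases lt_trichotomy j k with hjk | rfl | hjk
    · simp [hjk, hjk.not_gt]
    · simp [hdiag]
    · simp [hjk, hjk.not_gt, hsymm j k]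
  simp only [sum_filter]
  rw [sum_congr rfl fun j _ => sum_congr rfl fun k _ => hsplit j k]
  simp only [sum_add_distrib]
  rw [sum_comm (f := fun j k => if k < j then f k j else 0)]
  ring

theorem sum_filter_ne_of_self_eq_zero [Fintype ι] [DecidableEq ι] (j : ι) {f : ι → ℝ}
    (hj : f j = 0) : ∑ k ∈ univ.filter (fun k => k ≠ j), f k = ∑ k, f k := by
  rw [filter_ne', sum_erase _ hj]

end

theorem stmt12 (n : ℕ) (hn : 1 ≤ n) (h : ℝ)
    (θ U : Fin n → ℝ)
    (hθ : ∀ j k : Fin n, j ≠ k → Real.sin ((θ j - θ k) / 2) ≠ 0)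
    (hnv : ∀ j : Fin n,
      (1 / 2) * U j ^ 2
        + ∑ k ∈ univ.filter (fun k => k ≠ j),
            Real.cos ((θ k - θ j) / 2) / Real.sin ((θ k - θ j) / 2) * U k
        - ∑ k ∈ univ.filter (fun k => k ≠ j),
            3 / (2 * Real.sin ((θ j - θ k) / 2) ^ 2) = h) :
    ∑ j, pmom n θ U j ^ 2 / 2
      - 4 * ∑ j, ∑ k ∈ univ.filter (fun k => j < k),
          1 / Real.sin ((θ j - θ k) / 2) ^ 2
      = (n : ℝ) * h - (n : ℝ) * ((n : ℝ) ^ 2 - 1) / 6 := by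
  have hp (j : Fin n) : pmom n θ U j = U j + ∑ k, cotHalf θ j k :=
    congrArg (U j + ·) (sum_filter_ne_of_self_eq_zero j (cotHalf_self θ j))
  have hnull (j : Fin n) : 1 / 2 * U j ^ 2 + ∑ k, cotHalf θ k j * U k
      - 3 / 2 * ∑ k, cscSqHalf θ j k = h := by
    rw [← hnv j, sum_filter_ne_of_self_eq_zero j (by simp),
      sum_filter_ne_of_self_eq_zero j (by simp), mul_sum]
    refine congrArg _ (sum_congr rfl fun k _ => ?_)
    rw [cscSqHalf, div_mul_div_comm, mul_one]
  have hsum : 1 / 2 * ∑ j, U j ^ 2 + ∑ j, U j * ∑ k, cotHalf θ j k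
      - 3 / 2 * ∑ j, ∑ k, cscSqHalf θ j k = n * h := by
    have hcomm : ∑ j, U j * ∑ k, cotHalf θ j k = ∑ j, ∑ k, cotHalf θ k j * U k := by
      rw [sum_comm]
      simp only [mul_sum, mul_comm]
    have hall := sum_congr rfl fun j (_ : j ∈ (univ : Finset (Fin n))) => hnull j
    simp only [sum_sub_distrib, sum_add_distrib, ← mul_sum] at hall
    rw [hcomm, hall]
    simp
  have hkin : ∑ j, pmom n θ U j ^ 2 / 2 = 1 / 2 * ∑ j, U j ^ 2
      + ∑ j, U j * ∑ k, cotHalf θ j k + 1 / 2 * ∑ j, (∑ k, cotHalf θ j k) ^ 2 := by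
    rw [mul_sum, mul_sum, ← sum_add_distrib, ← sum_add_distrib]
    refine sum_congr rfl fun j _ => ?_
    rw [hp]
    ring
  have hpot := sum_sum_eq_two_mul_sum_lt (cscSqHalf_comm θ) (cscSqHalf_self θ)
  have hcot := sum_sq_sum_cotHalf hθ
  rw [Fintype.card_fin] at hcot
  change _ - 4 * ∑ j, ∑ k ∈ univ.filter (fun k => j < k), cscSqHalf θ j k = _
  linarith
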